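/- arXiv:2508.07291 — 5 statements merged into one kernel-verified Lean document; each statement's English description precedes it below -/
import Mathlib

section
/- Fix ν ∈ (0,1], β > 2, a nonzero integer k, and ξ ∈ ℝ. Set p(s) = k² + (ξ − k·s)², c(s) = max(ξ/k, min(s, ξ/k + β·ν^(−1/3))), and φ(t) = p(c(t))/p(c(0)). Then for every t ≥ 0 one has 1 ≤ φ(t) ≤ 1 + β²·ν^(−2/3); in particular φ(t) ≲ ν^(−2/3) with a constant depending only on β. (This is the bound 1 ≤ φ ≤ β²ν^(−2/3) of Lemma 3.1 of the paper, with the sharp constant 1 + β²ν^(−2/3).) -/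
/-- The bound `1 ≤ φ ≤ 1 + β² ν^{-2/3}` for the Fourier multiplier `φ`
(part of Lemma 3.1 of the paper, with the sharp constant `1 + β² ν^{-2/3}`). -/
theorem phi_bounds (ν : ℝ) (hν : 0 < ν) (hν1 : ν ≤ 1) (β : ℝ) (hβ : 2 < β)
    (k : ℤ) (hk : k ≠ 0) (ξ : ℝ)
    (p c φ : ℝ → ℝ)
    (hp : ∀ s : ℝ, p s = (k:ℝ)^2 + (ξ - (k:ℝ) * s)^2)
    (hc : ∀ s : ℝ, c s = max (ξ / (k:ℝ)) (min s (ξ / (k:ℝ) + β * ν ^ (-(1:ℝ)/3))))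
    (hφ : ∀ t : ℝ, φ t = p (c t) / p (c 0)) :
    ∀ t : ℝ, 0 ≤ t → 1 ≤ φ t ∧ φ t ≤ 1 + β^2 * ν ^ (-(2:ℝ)/3) := by
  intro t ht
  have hk' : (k:ℝ) ≠ 0 := by exact_mod_cast hk
  have hk2 : 0 < (k:ℝ)^2 := by positivity
  have hB : (ν ^ (-(1:ℝ)/3))^2 = ν ^ (-(2:ℝ)/3) := by
    rw [← Real.rpow_natCast, ← Real.rpow_mul hν.le]
    norm_num
  have hpos : 0 < ν ^ (-(1:ℝ)/3) := Real.rpow_pos_of_pos hν _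
  rw [← hB, ← mul_pow]
  have hBp : 0 < β * ν ^ (-(1:ℝ)/3) := by positivity
  generalize β * ν ^ (-(1:ℝ)/3) = B at hc hBp ⊢
  have hp' : ∀ s, p s = (k:ℝ)^2 * (1 + (s - ξ / k)^2) := by
    intro s
    rw [hp]
    field_simp
    ring
  have h0 : ξ / k ≤ c 0 := by rw [hc]; exact le_max_left _ _
  have h1 : c 0 ≤ c t := by
    rw [hc, hc]
    exact max_le_max le_rfl (min_le_min ht le_rfl)
  have h2 : c t ≤ ξ / k + B := by
    rw [hc]
    exact max_le (by linarith) (min_le_right _ _)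
  rw [hφ, hp', hp', mul_div_mul_left _ _ hk2.ne']
  have hd : 0 < 1 + (c 0 - ξ / k)^2 := by positivity
  have h3 : (c 0 - ξ / k)^2 ≤ (c t - ξ / k)^2 :=
    pow_le_pow_left₀ (by linarith) (by linarith) 2
  have h4 : (c t - ξ / k)^2 ≤ B^2 :=
    pow_le_pow_left₀ (by linarith) (by linarith) 2
  constructor
  · rw [le_div_iff₀ hd]
    linarith
  · rw [div_le_iff₀ hd]
    nlinarith [mul_nonneg (sq_nonneg B) (sq_nonneg (c 0 - ξ / k)), sq_nonneg (c 0 - ξ / k)]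
end

section
/- Fix ν ∈ (0,1], β > 2, a nonzero integer k, and ξ ∈ ℝ. Set p(s) = k² + (ξ − k·s)², c(s) = max(ξ/k, min(s, ξ/k + β·ν^(−1/3))), and φ(t) = p(c(t))/p(c(0)). Then for every t ≥ 0 one has φ(t)·k² ≤ p(t), that is, φ(t)/p(t) ≤ 1/k². (This is the estimate φ/p ≤ 1/k² of Lemma 3.1 of the paper.) -/
/-- The estimate `φ/p ≤ 1/k²`, i.e. `φ k² ≤ p`, for the Fourier multiplier `φ`
(part of Lemma 3.1 of the paper). -/
theorem phi_le_p_div_ksq (ν : ℝ) (hν : 0 < ν) (hν1 : ν ≤ 1) (β : ℝ) (hβ : 2 < β)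
    (k : ℤ) (hk : k ≠ 0) (ξ : ℝ)
    (p c φ : ℝ → ℝ)
    (hp : ∀ s : ℝ, p s = (k:ℝ)^2 + (ξ - (k:ℝ) * s)^2)
    (hc : ∀ s : ℝ, c s = max (ξ / (k:ℝ)) (min s (ξ / (k:ℝ) + β * ν ^ (-(1:ℝ)/3))))
    (hφ : ∀ t : ℝ, φ t = p (c t) / p (c 0)) :
    ∀ t : ℝ, 0 ≤ t → φ t * (k:ℝ)^2 ≤ p t ∧ φ t / p t ≤ 1 / (k:ℝ)^2 := by
  intro t _
  have hk' : (k:ℝ) ≠ 0 := by exact_mod_cast hk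
  have hk2 : 0 < (k:ℝ)^2 := by positivity
  have hL : 0 < β * ν ^ (-(1:ℝ)/3) := mul_pos (by linarith) (Real.rpow_pos_of_pos hν _)
  have hp' : ∀ s : ℝ, p s = (k:ℝ)^2 + (k:ℝ)^2 * (s - ξ / (k:ℝ))^2 := by
    intro s
    rw [hp]
    field_simp
    ring
  have hge : ∀ s : ℝ, (k:ℝ)^2 ≤ p s := by
    intro s
    rw [hp]
    nlinarith [sq_nonneg (ξ - (k:ℝ) * s)]
  have hct : (c t - ξ / (k:ℝ))^2 ≤ (t - ξ / (k:ℝ))^2 := by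
    rw [hc]
    generalize ξ / (k:ℝ) = a
    generalize β * ν ^ (-(1:ℝ)/3) = L at hL
    rcases le_total t a with h | h
    · rw [max_eq_left ((min_le_left _ _).trans h)]
      nlinarith [sq_nonneg (t - a)]
    · have h1 : a ≤ min t (a + L) := le_min h (by linarith)
      rw [max_eq_right h1]
      have h2 : min t (a + L) ≤ t := min_le_left _ _
      exact pow_le_pow_left₀ (by linarith) (by linarith) 2
  have hpc : p (c t) ≤ p t := by
    rw [hp', hp' t]
    nlinarith [mul_le_mul_of_nonneg_left hct hk2.le]
  have h0 : 0 < p (c 0) := hk2.trans_le (hge _)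
  have main : φ t * (k:ℝ)^2 ≤ p t := by
    rw [hφ, div_mul_eq_mul_div, div_le_iff₀ h0]
    exact mul_le_mul hpc (hge _) hk2.le (hk2.le.trans (hge _))
  refine ⟨main, ?_⟩
  rw [div_le_div_iff₀ (hk2.trans_le (hge t)) hk2, one_mul]
  exact main
end

section
/- Let 0 < ν ≤ 1, β > 2, let k be a nonzero integer, ξ ∈ ℝ, and t ∈ ℝ with |t − ξ/k| ≥ β·ν^(−1/3). Then, with p(t) = k² + (ξ − k·t)² and ∂ₜp(t) = −2k(ξ − k·t), one has ∂ₜp(t)/p(t) ≤ (1/4)·ν·p(t). (This is the claim of the paper that sufficiently far from the critical layer the growth factor ∂ₜp/p is dominated by the dissipation νp.) -/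
/-- Away from the critical layer, i.e. for `|t − ξ/k| ≥ β ν^{-1/3}` with `β > 2`,
the growth factor `∂ₜp/p` is dominated by a quarter of the dissipation `ν p`,
where `p(t) = k² + (ξ − kt)²` and `∂ₜp(t) = −2k(ξ − kt)`. -/
theorem growth_dominated_by_dissipation (ν β : ℝ) (hν : 0 < ν) (hν1 : ν ≤ 1) (hβ : 2 < β)
    (k : ℤ) (hk : k ≠ 0) (ξ t : ℝ)
    (ht : β * ν ^ (-(1:ℝ)/3) ≤ |t - ξ / (k:ℝ)|) :
    (-2 * (k:ℝ) * (ξ - (k:ℝ) * t)) / ((k:ℝ)^2 + (ξ - (k:ℝ) * t)^2)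
      ≤ (1/4) * ν * ((k:ℝ)^2 + (ξ - (k:ℝ) * t)^2) := by
  have hkR : (k:ℝ) ≠ 0 := by exact_mod_cast hk
  have hk1 : (1:ℝ) ≤ (k:ℝ)^2 := by
    have h : (1:ℤ) ≤ k^2 := by
      have : 0 < k^2 := by positivity
      omega
    exact_mod_cast h
  obtain ⟨s, hs⟩ : ∃ s, s = t - ξ / (k:ℝ) := ⟨_, rfl⟩
  have hx : ξ - (k:ℝ) * t = -((k:ℝ) * s) := by
    rw [hs]; field_simp; ring
  rw [← hs] at ht
  rw [hx]
  set a := ν ^ (-(1:ℝ)/3) with ha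
  have ha0 : 0 < a := Real.rpow_pos_of_pos hν _
  have ha3 : ν * a^3 = 1 := by
    rw [ha, ← Real.rpow_natCast, ← Real.rpow_mul hν.le]
    norm_num
    rw [Real.rpow_neg_one]
    exact mul_inv_cancel₀ hν.ne'
  have h2 : 2 * a ≤ |s| := le_trans (by nlinarith) ht
  have h3 : (2 * a)^3 ≤ |s|^3 := pow_le_pow_left₀ (by positivity) h2 3
  have h4 : 8 ≤ ν * |s|^3 := by
    have := mul_le_mul_of_nonneg_left h3 hν.le
    nlinarith
  have h5 : 8 * |s| ≤ ν * s^4 := by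
    have h6 := mul_le_mul_of_nonneg_right h4 (abs_nonneg s)
    have h7 : |s|^4 = s^4 := by
      rw [show |s|^4 = (|s|^2)^2 by ring, sq_abs]; ring
    rw [← h7]; linarith
  have h8 : 8 * s ≤ ν * (1 + s^2)^2 := by
    have := le_abs_self s
    have : 0 ≤ ν * (1 + 2 * s^2) := by positivity
    nlinarith
  have h9 : ν * (1 + s^2)^2 ≤ (k:ℝ)^2 * (ν * (1 + s^2)^2) :=
    le_mul_of_one_le_left (by positivity) hk1
  have h10 := mul_le_mul_of_nonneg_left (h8.trans h9) (sq_nonneg (k:ℝ))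
  rw [div_le_iff₀ (by positivity)]
  linarith
end

section
/- Let 0 < ν ≤ 1, β > 2, and let δ be a real number with max(2/(β(β²−1)), 4/β) < δ ≤ 1. Let k be a nonzero integer, ξ ∈ ℝ, and t ≥ 0. Set p(t) = k² + (ξ − k·t)², ∂ₜp(t) = −2k(ξ − k·t), and let χ(t) = 1 if ξ/k ≤ t ≤ ξ/k + β·ν^(−1/3) and χ(t) = 0 otherwise. Then δ·( 2·ν^(1/3)/(1 + ν^(2/3)·(ξ/k − t)²) + ν·p(t) ) + (χ(t) − 1)·∂ₜp(t)/p(t) ≥ δ·ν^(1/3). (This is the first inequality of (3.6) in Lemma 3.1 of the paper, since ∂ₜm₁/m₁ = 2ν^(1/3)/(1 + ν^(2/3)(ξ/k − t)²) and ∂ₜφ/φ − ∂ₜp/p = (χ(t) − 1)·∂ₜp/p.) -/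
/-- The first inequality of (3.6) in Lemma 3.1 of the paper:
`δ(∂ₜm₁/m₁ + νp) + ∂ₜφ/φ − ∂ₜp/p ≥ δ ν^{1/3}`, where
`∂ₜm₁/m₁ = 2ν^{1/3}/(1 + ν^{2/3}(ξ/k − t)²)` and
`∂ₜφ/φ − ∂ₜp/p = (χ(t) − 1) ∂ₜp/p` with `χ` the indicator of the critical interval. -/
theorem multiplier_inequality_one (ν β δ : ℝ) (hν : 0 < ν) (hν1 : ν ≤ 1) (hβ : 2 < β)
    (hδ : max (2 / (β * (β^2 - 1))) (4 / β) < δ) (hδ1 : δ ≤ 1)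
    (k : ℤ) (hk : k ≠ 0) (ξ t : ℝ) (ht : 0 ≤ t)
    (p ptp χ : ℝ)
    (hp : p = (k:ℝ)^2 + (ξ - (k:ℝ) * t)^2)
    (hptp : ptp = -2 * (k:ℝ) * (ξ - (k:ℝ) * t))
    (hχ : χ = if ξ / (k:ℝ) ≤ t ∧ t ≤ ξ / (k:ℝ) + β * ν ^ (-(1:ℝ)/3) then 1 else 0) :
    δ * (2 * ν ^ ((1:ℝ)/3) / (1 + ν ^ ((2:ℝ)/3) * (ξ / (k:ℝ) - t)^2) + ν * p)
      + (χ - 1) * ptp / p ≥ δ * ν ^ ((1:ℝ)/3) := by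
  have hk' : (k:ℝ) ≠ 0 := by exact_mod_cast hk
  have hk1 : (1:ℝ) ≤ (k:ℝ)^2 := by
    have : (1:ℤ) ≤ k^2 := by
      have := sq_pos_of_ne_zero hk
      omega
    exact_mod_cast this
  have hδ4 : 4 / β < δ := lt_of_le_of_lt (le_max_right _ _) hδ
  have hβ0 : 0 < β := by linarith
  have hδ0 : 0 < δ := lt_trans (by positivity) hδ4
  obtain ⟨a, ha⟩ : ∃ a, a = ν ^ ((1:ℝ)/3) := ⟨_, rfl⟩
  have ha0 : 0 < a := by rw [ha]; positivity
  have ha2 : ν ^ ((2:ℝ)/3) = a^2 := by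
    rw [ha, ← Real.rpow_natCast, ← Real.rpow_mul hν.le]; norm_num
  have ha3 : ν = a^3 := by
    rw [ha, ← Real.rpow_natCast, ← Real.rpow_mul hν.le]; norm_num
  have hai : ν ^ (-(1:ℝ)/3) = a⁻¹ := by
    rw [ha, ← Real.rpow_neg hν.le]; norm_num
  rw [ha2, ← ha]
  rw [hai] at hχ
  obtain ⟨s, hs⟩ : ∃ s, s = t - ξ / (k:ℝ) := ⟨_, rfl⟩
  have e1 : ξ / (k:ℝ) = t - s := by rw [hs]; ring
  have e2 : ξ - (k:ℝ) * t = -((k:ℝ) * s) := by rw [hs]; field_simp; ring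
  have e3 : (ξ / (k:ℝ) - t)^2 = s^2 := by rw [e1]; ring
  have hp' : p = (k:ℝ)^2 * (1 + s^2) := by rw [hp, e2]; ring
  have hq : ptp / p = 2 * s / (1 + s^2) := by
    have : (1 + s^2) ≠ 0 := by positivity
    rw [hp', hptp, e2]; field_simp
  rw [e3, mul_div_assoc (χ - 1), hq]
  have hνp : a * (a * s)^2 ≤ ν * p := by
    rw [hp', ha3]
    have h3 : 0 < a^3 := by positivity
    have : s^2 ≤ (k:ℝ)^2 * (1 + s^2) := by nlinarith [sq_nonneg s]
    nlinarith only [mul_le_mul_of_nonneg_left this h3.le]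
  have h2 : 2 * a / (1 + a^2 * s^2) = a * (2 / (1 + (a*s)^2)) := by
    rw [mul_pow]; ring
  have hy : 1 ≤ 2 / (1 + (a*s)^2) + (a*s)^2 := by
    have : 0 < 1 + (a*s)^2 := by positivity
    rw [div_add' _ _ _ this.ne', le_div_iff₀ this]
    nlinarith [sq_nonneg ((a*s)^2)]
  rw [h2]
  have core : δ * a ≤ δ * (a * (2 / (1 + (a*s)^2)) + ν * p) := by
    apply mul_le_mul_of_nonneg_left _ hδ0.le
    linarith only [mul_le_mul_of_nonneg_left hy ha0.le, hνp]
  by_cases hc : ξ / (k:ℝ) ≤ t ∧ t ≤ ξ / (k:ℝ) + β * a⁻¹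
  · rw [if_pos hc] at hχ
    rw [hχ]; linarith
  · rw [if_neg hc] at hχ
    rw [hχ]
    rcases lt_or_ge s 0 with hneg | hnn
    · have : 2 * s / (1 + s^2) ≤ 0 :=
        div_nonpos_of_nonpos_of_nonneg (by linarith) (by positivity)
      linarith
    · have hsb : β * a⁻¹ < s := by
        by_contra h
        exact hc ⟨by linarith, by linarith⟩
      have hu : β < a * s := by
        rw [← div_eq_mul_inv, div_lt_iff₀ ha0] at hsb
        linarith
      have hs0 : 0 < s := lt_of_le_of_lt (by positivity) hsb
      obtain ⟨u, hu'⟩ : ∃ u, u = a * s := ⟨_, rfl⟩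
      rw [← hu'] at hu hνp ⊢
      have hu0 : 0 < u := by linarith
      have hb : 2 * s / (1 + s^2) ≤ a * (2 / u) := by
        have : a * (2 / u) = 2 / s := by rw [hu']; field_simp
        rw [this, div_le_div_iff₀ (by positivity) hs0]
        nlinarith only [hs0]
      have hδu : 4 < δ * u := by
        rw [div_lt_iff₀ hβ0] at hδ4
        exact lt_trans hδ4 (mul_lt_mul_of_pos_left hu hδ0)
      have hm : 2 / u ≤ δ * (u^2 - 1) := by
        rw [div_le_iff₀ hu0]
        have h3 : 3 ≤ u^2 - 1 := by nlinarith only [hu, hβ]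
        have h4 : 4 * 3 ≤ (δ * u) * (u^2 - 1) :=
          mul_le_mul hδu.le h3 (by norm_num) (by positivity)
        linarith only [h4]
      have h5 : 0 ≤ δ * (a * (2 / (1 + u^2))) := by positivity
      have h6 := mul_le_mul_of_nonneg_left hm ha0.le
      have h7 := mul_le_mul_of_nonneg_left hνp hδ0.le
      have h8 : δ * (a * u^2) = a * (δ * (u^2 - 1)) + δ * a := by ring
      have h9 : δ * (a * (2 / (1 + u^2)) + ν * p)
        = δ * (a * (2 / (1 + u^2))) + δ * (ν * p) := by ring
      rw [h9]
      linarith only [h5, h6, h7, h8, hb]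
end

section
/- Let 0 < ν ≤ 1, β > 2, and let δ be a real number with max(2/(β(β²−1)), 4/β) < δ ≤ 1. Let k be a nonzero integer, ξ ∈ ℝ, and t ≥ 0. Set p(t) = k² + (ξ − k·t)², ∂ₜp(t) = −2k(ξ − k·t), and let χ(t) = 1 if ξ/k ≤ t ≤ ξ/k + β·ν^(−1/3) and χ(t) = 0 otherwise. Then δ·( 2·ν^(1/3)/(1 + ν^(2/3)·(ξ/k − t)²) + ν^(1/3) ) + (χ(t) − 1)·∂ₜp(t)/p(t) ≥ (δ/2)·ν^(1/3). (This is the second inequality of (3.6) in Lemma 3.1 of the paper.) -/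
/-- The second inequality of (3.6) in Lemma 3.1 of the paper:
`δ(∂ₜm₁/m₁ + ν^{1/3}) + ∂ₜφ/φ − ∂ₜp/p ≥ (δ/2) ν^{1/3}`, where
`∂ₜm₁/m₁ = 2ν^{1/3}/(1 + ν^{2/3}(ξ/k − t)²)` and
`∂ₜφ/φ − ∂ₜp/p = (χ(t) − 1) ∂ₜp/p` with `χ` the indicator of the critical interval. -/
theorem multiplier_inequality_two (ν β δ : ℝ) (hν : 0 < ν) (hν1 : ν ≤ 1) (hβ : 2 < β)
    (hδ : max (2 / (β * (β^2 - 1))) (4 / β) < δ) (hδ1 : δ ≤ 1)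
    (k : ℤ) (hk : k ≠ 0) (ξ t : ℝ) (ht : 0 ≤ t)
    (p ptp χ : ℝ)
    (hp : p = (k:ℝ)^2 + (ξ - (k:ℝ) * t)^2)
    (hptp : ptp = -2 * (k:ℝ) * (ξ - (k:ℝ) * t))
    (hχ : χ = if ξ / (k:ℝ) ≤ t ∧ t ≤ ξ / (k:ℝ) + β * ν ^ (-(1:ℝ)/3) then 1 else 0) :
    δ * (2 * ν ^ ((1:ℝ)/3) / (1 + ν ^ ((2:ℝ)/3) * (ξ / (k:ℝ) - t)^2) + ν ^ ((1:ℝ)/3))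
      + (χ - 1) * ptp / p ≥ (δ / 2) * ν ^ ((1:ℝ)/3) := by
  have hk' : (k:ℝ) ≠ 0 := by exact_mod_cast hk
  have hβ0 : 0 < β := by linarith
  have h4 : 4 / β < δ := lt_of_le_of_lt (le_max_right _ _) hδ
  have hδ0 : 0 < δ := lt_trans (by positivity) h4
  have ha : 0 < ν ^ ((1:ℝ)/3) := Real.rpow_pos_of_pos hν _
  have hb : 0 < ν ^ ((2:ℝ)/3) := Real.rpow_pos_of_pos hν _
  have hinv : ν ^ (-(1:ℝ)/3) = (ν ^ ((1:ℝ)/3))⁻¹ := by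
    rw [← Real.rpow_neg hν.le]; norm_num
  rw [hinv] at hχ
  have hq : ptp / p = 2 * (t - ξ / k) / (1 + (t - ξ / k)^2) := by
    have hpp : p = (k:ℝ)^2 * (1 + (t - ξ / k)^2) := by
      rw [hp]; field_simp; ring
    have hpt : ptp = (k:ℝ)^2 * (2 * (t - ξ / k)) := by
      rw [hptp]; field_simp; ring
    rw [hpp, hpt, mul_div_mul_left _ _ (pow_ne_zero 2 hk')]
  rw [mul_div_assoc (χ - 1), hq]
  generalize ν ^ ((1:ℝ)/3) = a at *
  generalize ν ^ ((2:ℝ)/3) = b at *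
  generalize ξ / (k:ℝ) = x at *
  have hm : 0 ≤ δ * (2 * a / (1 + b * (x - t)^2)) := by positivity
  have hda : 0 < δ * a := by positivity
  rw [mul_add]
  have hs : 0 < 1 + (t - x)^2 := by positivity
  split_ifs at hχ with h
  · subst hχ; linarith
  · subst hχ
    suffices 2 * (t - x) / (1 + (t - x)^2) ≤ δ * a / 2 by linarith
    rcases lt_or_ge t x with h1 | h1
    · have : 2 * (t - x) / (1 + (t - x)^2) ≤ 0 :=
        div_nonpos_of_nonpos_of_nonneg (by linarith) hs.le
      linarith
    · have h2 : β * a⁻¹ < t - x := by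
        by_contra hc
        exact h ⟨h1, by linarith⟩
      rw [div_le_iff₀ hs]
      have h3 : β < (t - x) * a := by
        rwa [← div_eq_mul_inv, div_lt_iff₀ ha] at h2
      have h5 : 4 < δ * β := by rwa [div_lt_iff₀ hβ0] at h4
      have h6 : 4 < δ * a * (t - x) := by nlinarith
      nlinarith [mul_le_mul_of_nonneg_right h6.le (sub_nonneg.2 h1)]
end
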